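/- Let p, q, r ≥ 1 and let d be a positive integer. Let W = (EuclideanSpace ℝ (Fin p)) ⊗ (EuclideanSpace ℝ (Fin q)) ⊗ (EuclideanSpace ℝ (Fin r)) and let W^{⊗d} be its d-fold tensor power over ℝ, on which H = O(p) × O(q) × O(r) acts by applying the three orthogonal matrices in the corresponding factors of each tensor slot: (B,C,D)·((u_1⊗v_1⊗w_1) ⊗ ⋯ ⊗ (u_d⊗v_d⊗w_d)) = (Bu_1⊗Cv_1⊗Dw_1) ⊗ ⋯ ⊗ (Bu_d⊗Cv_d⊗Dw_d). For a colored Brauer diagram (σ,τ,ρ) on d vertices define T_{(σ,τ,ρ)} = Σ (e_{a(1)} ⊗ f_{b(1)} ⊗ g_{c(1)}) ⊗ ⋯ ⊗ (e_{a(d)} ⊗ f_{b(d)} ⊗ g_{c(d)}), the sum over all a : Fin d → Fin p with a∘σ = a, b : Fin d → Fin q with b∘τ = b, and c : Fin d → Fin r with c∘ρ = c, where e, f, g are the standard bases of ℝ^p, ℝ^q, ℝ^r. Then the subspace of H-invariant tensors in W^{⊗d} equals the ℝ-linear span of the tensors T_{(σ,τ,ρ)} over all colored Brauer diagrams on d vertices.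 -/

import Mathlib

open scoped TensorProduct

/-- A Brauer diagram on `d` vertices: a fixed-point-free involution of `Fin d`. -/
def IsBrauerDiagram {d : ℕ} (σ : Equiv.Perm (Fin d)) : Prop :=
  (∀ x, σ (σ x) = x) ∧ ∀ x, σ x ≠ x

/-- The tensor associated to a colored Brauer diagram `(σ, τ, ρ)` in `W^{⊗d}`, where
`W = ℝ^p ⊗ ℝ^q ⊗ ℝ^r`. -/
noncomputable def coloredBrauerTensor (p q r d : ℕ) (σ τ ρ : Equiv.Perm (Fin d)) :
    ⨂[ℝ] _ : Fin d,
      (EuclideanSpace ℝ (Fin p) ⊗[ℝ] (EuclideanSpace ℝ (Fin q) ⊗[ℝ] EuclideanSpace ℝ (Fin r))) :=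
  ∑ a ∈ Finset.univ.filter (fun a : Fin d → Fin p => a ∘ ⇑σ = a),
    ∑ b ∈ Finset.univ.filter (fun b : Fin d → Fin q => b ∘ ⇑τ = b),
      ∑ c ∈ Finset.univ.filter (fun c : Fin d → Fin r => c ∘ ⇑ρ = c),
        PiTensorProduct.tprod ℝ (fun t =>
          EuclideanSpace.single (a t) (1 : ℝ) ⊗ₜ[ℝ]
            (EuclideanSpace.single (b t) (1 : ℝ) ⊗ₜ[ℝ] EuclideanSpace.single (c t) (1 : ℝ)))

/-- A perfect matching of `α`, presented as a fixed-point-free involution. -/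
def IsPerfectMatching {α : Type*} (σ : Equiv.Perm α) : Prop :=
  (∀ x, σ (σ x) = x) ∧ ∀ x, σ x ≠ x

theorem IsPerfectMatching.exists_cycleType {α : Type*} [Fintype α] [DecidableEq α]
    {σ : Equiv.Perm α} (h : IsPerfectMatching σ) :
    ∃ k, Fintype.card α = 2 * k ∧ σ.cycleType = Multiset.replicate k 2 := by
  have hpow : orderOf σ ∣ 2 := orderOf_dvd_of_pow_eq_one (by
    ext x; simp [pow_two, h.1 x])
  have hrep : σ.cycleType = Multiset.replicate (Multiset.card σ.cycleType) 2 := by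
    refine Multiset.eq_replicate_card.2 fun m hm => ?_
    have h1 := Equiv.Perm.two_le_of_mem_cycleType hm
    have h2 := Nat.le_of_dvd two_pos ((Equiv.Perm.dvd_of_mem_cycleType hm).trans hpow)
    omega
  refine ⟨_, ?_, hrep⟩
  have hsupp : σ.support = Finset.univ := by
    ext x; simp [h.2 x]
  have hsum := σ.sum_cycleType
  rw [hsupp, Finset.card_univ, hrep] at hsum
  simp at hsum
  omega

theorem isPerfectMatching_iff_cycleType {α : Type*} [Fintype α] [DecidableEq α]
    {σ : Equiv.Perm α} {k : ℕ} (hk : Fintype.card α = 2 * k) :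
    IsPerfectMatching σ ↔ σ.cycleType = Multiset.replicate k 2 := by
  constructor
  · intro h
    obtain ⟨m, hm, hσ⟩ := h.exists_cycleType
    obtain rfl : m = k := by omega
    exact hσ
  · intro h
    have hord : orderOf σ ∣ 2 := by
      rw [← Equiv.Perm.lcm_cycleType, h]
      exact Multiset.lcm_dvd.2 fun b hb => (Multiset.eq_of_mem_replicate hb).dvd
    have hsq := orderOf_dvd_iff_pow_eq_one.1 hord
    refine ⟨fun x => by simpa [pow_two] using congrArg (fun τ : Equiv.Perm α => τ x) hsq, ?_⟩
    have hsupp : σ.support = Finset.univ := by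
      rw [← Finset.card_eq_iff_eq_univ, ← Equiv.Perm.sum_cycleType, h, hk]
      simp [mul_comm]
    intro x
    rw [← Equiv.Perm.mem_support, hsupp]
    exact Finset.mem_univ x

open scoped Nat

open scoped Classical in
theorem card_isPerfectMatching (α : Type*) [Fintype α] :
    Fintype.card {σ : Equiv.Perm α // IsPerfectMatching σ} =
      if Even (Fintype.card α) then (Fintype.card α - 1)‼ else 0 := by
  split_ifs with h
  · obtain ⟨k, hk⟩ := h
    rw [← two_mul] at hk
    have hcard := Equiv.Perm.card_of_cycleType_mul_eq α (Multiset.replicate k 2)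
    rw [Fintype.card_subtype]
    simp_rw [isPerfectMatching_iff_cycleType hk]
    rw [if_pos ⟨by simp [hk, mul_comm], fun a ha => (Multiset.eq_of_mem_replicate ha).ge⟩,
      hk] at hcard
    rw [hk]
    rcases k with _ | k
    · simpa using hcard
    · rw [Multiset.toFinset_replicate, if_neg (Nat.succ_ne_zero k)] at hcard
      simp only [Multiset.sum_replicate, Multiset.prod_replicate, Finset.prod_singleton,
        Multiset.count_replicate_self, smul_eq_mul] at hcard
      have h1 := Nat.factorial_eq_mul_doubleFactorial (2 * k + 1)
      rw [show 2 * k + 1 + 1 = 2 * (k + 1) by ring, Nat.doubleFactorial_two_mul] at h1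
      rw [h1, mul_comm (k + 1) 2, Nat.sub_self, Nat.factorial_zero, one_mul, mul_comm] at hcard
      exact Nat.eq_of_mul_eq_mul_left (by positivity) hcard
  · rw [Fintype.card_eq_zero_iff]
    refine ⟨fun σ => h ?_⟩
    obtain ⟨k, hk, -⟩ := σ.2.exists_cycleType
    exact ⟨k, by omega⟩

open MeasureTheory ProbabilityTheory in
theorem integral_pow_gaussianReal (n : ℕ) :
    ∫ x, x ^ n ∂(gaussianReal 0 1) = if Even n then ((n - 1)‼ : ℝ) else 0 := by
  rw [integral_gaussianReal_eq_integral_smul one_ne_zero]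
  simp only [gaussianPDFReal, smul_eq_mul, sub_zero, NNReal.coe_one, mul_one]
  split_ifs with h
  · obtain ⟨k, rfl⟩ := h
    have h1 := integral_comp_abs (f := fun x : ℝ => (√(2 * Real.pi))⁻¹ * Real.exp (-x ^ 2 / 2) * x ^ (k + k))
    simp only [sq_abs, (show Even (k + k) from ⟨k, rfl⟩).pow_abs] at h1
    have h2 := integral_rpow_mul_exp_neg_mul_rpow (p := 2) (q := ((2 * k : ℕ) : ℝ)) (b := 1 / 2)
      two_pos (by have : (0 : ℝ) ≤ ((2 * k : ℕ) : ℝ) := by positivity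
                  linarith) (by norm_num)
    have h3 : ∫ x in Set.Ioi (0 : ℝ), (√(2 * Real.pi))⁻¹ * Real.exp (-x ^ 2 / 2) * x ^ (k + k) =
        (√(2 * Real.pi))⁻¹ * ∫ x in Set.Ioi (0 : ℝ),
          x ^ ((2 * k : ℕ) : ℝ) * Real.exp (-(1 / 2) * x ^ (2 : ℝ)) := by
      rw [← integral_const_mul]
      congr 1 with x
      rw [Real.rpow_natCast, Real.rpow_two, ← two_mul, mul_assoc, mul_comm (x ^ (2 * k))]
      ring_nf
    rw [h1, h3, h2, show (((2 * k : ℕ) : ℝ) + 1) / 2 = k + 1 / 2 by push_cast; ring,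
      Real.Gamma_nat_add_half, ← two_mul,
      show -(((2 * k : ℕ) : ℝ) + 1) / 2 = -(k : ℝ) + -(1 / 2) by push_cast; ring,
      Real.rpow_add (by norm_num), Real.rpow_neg (by norm_num), Real.rpow_neg (by norm_num),
      Real.rpow_natCast, ← Real.sqrt_eq_rpow, Real.sqrt_mul zero_le_two, one_div (2 : ℝ), Real.sqrt_inv]
    have : √Real.pi ≠ 0 := by positivity
    simp
    field_simp
  · have hodd := Nat.not_even_iff_odd.1 h
    have h1 := integral_neg_eq_self (fun x : ℝ => (√(2 * Real.pi))⁻¹ * Real.exp (-x ^ 2 / 2) * x ^ n) volume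
    simp only [even_two.neg_pow, hodd.neg_pow, mul_neg, integral_neg] at h1
    linarith

open scoped Classical in
theorem integral_pow_card_gaussianReal (α : Type*) [Fintype α] :
    ∫ x, x ^ Fintype.card α ∂(ProbabilityTheory.gaussianReal 0 1) =
      Fintype.card {σ : Equiv.Perm α // IsPerfectMatching σ} := by
  rw [integral_pow_gaussianReal, card_isPerfectMatching]
  split_ifs <;> simp

/-- A perfect matching preserving a colouring is the same as a matching of each colour class. -/
def matchingStabilizerEquiv {α κ : Type*} (f : α → κ) :
    {σ : Equiv.Perm α // IsPerfectMatching σ ∧ f ∘ σ = f} ≃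
      ∀ k, {σ : Equiv.Perm {x // f x = k} // IsPerfectMatching σ} where
  toFun σ k := ⟨σ.1.subtypePerm fun x => by
      rw [← Function.comp_apply (f := f), σ.2.2],
    fun x => Subtype.ext (σ.2.1.1 x), fun x hx => σ.2.1.2 x (congrArg Subtype.val hx)⟩
  invFun g := ⟨DomMulAct.stabilizerEquiv_invFun_aux fun k => (g k).1, by
    refine ⟨⟨fun x => ?_, fun x hx => (g (f x)).2.2 ⟨x, rfl⟩ (Subtype.ext hx)⟩,
      funext fun x => DomMulAct.comp_stabilizerEquiv_invFun (fun k => (g k).1) x⟩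
    refine (DomMulAct.stabilizerEquiv_invFun_eq (fun k => (g k).1)
      (DomMulAct.comp_stabilizerEquiv_invFun (fun k => (g k).1) x)).trans ?_
    exact congrArg Subtype.val ((g (f x)).2.1 ⟨x, rfl⟩)⟩
  left_inv _ := rfl
  right_inv g := by
    ext k x
    exact DomMulAct.stabilizerEquiv_invFun_eq (fun k => (g k).1) x.2

open scoped Classical in
theorem prod_comp_eq_prod_pow_card {α κ : Type*} [Fintype α] [Fintype κ] (f : α → κ) (g : κ → ℝ) :
    ∏ t, g (f t) = ∏ k, g k ^ Fintype.card {x // f x = k} := by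
  rw [← Finset.prod_fiberwise (s := Finset.univ) (g := f)]
  refine Finset.prod_congr rfl fun k _ => ?_
  rw [Finset.prod_congr rfl (g := fun _ => g k) fun t ht => by rw [(Finset.mem_filter.1 ht).2],
    Finset.prod_const, Fintype.card_subtype]

open scoped Classical in
open MeasureTheory ProbabilityTheory in
theorem integral_prod_comp_gaussian {α κ : Type*} [Fintype α] [Fintype κ] (f : α → κ) :
    ∫ g : κ → ℝ, ∏ t, g (f t) ∂(Measure.pi fun _ => gaussianReal 0 1) =
      ∑ σ : {σ : Equiv.Perm α // IsPerfectMatching σ}, if f ∘ σ.1 = f then (1 : ℝ) else 0 := by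
  simp_rw [prod_comp_eq_prod_pow_card f]
  rw [integral_fintype_prod_eq_prod (f := fun k (x : ℝ) => x ^ Fintype.card {x // f x = k})]
  have h3 (k : κ) : ∫ x, x ^ Fintype.card {x // f x = k} ∂(gaussianReal 0 1) =
      Fintype.card {σ : Equiv.Perm {x // f x = k} // IsPerfectMatching σ} := by
    convert! integral_pow_card_gaussianReal _
  simp_rw [h3]
  have h2 : Fintype.card {σ : Equiv.Perm α // IsPerfectMatching σ ∧ f ∘ σ = f} =
      ∏ k, Fintype.card {σ : Equiv.Perm {x // f x = k} // IsPerfectMatching σ} := by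
    rw [Fintype.card_congr (matchingStabilizerEquiv f), Fintype.card_pi]
  rw [← Nat.cast_prod, ← h2, Finset.sum_boole, ← Fintype.card_subtype]
  exact congrArg _ (Fintype.card_congr (Equiv.subtypeSubtypeEquivSubtypeInter
    (fun σ : Equiv.Perm α => IsPerfectMatching σ) (fun σ => f ∘ σ = f)).symm)

open MeasureTheory ProbabilityTheory in
theorem integrable_prod_comp_gaussian {α κ : Type*} [Fintype α] [Fintype κ] (f : α → κ) :
    Integrable (fun g : κ → ℝ => ∏ t, g (f t)) (Measure.pi fun _ => gaussianReal 0 1) := by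
  classical
  have h1 : (fun g : κ → ℝ => ∏ t, g (f t)) =
      fun g : κ → ℝ => ∏ k, g k ^ Fintype.card {x // f x = k} :=
    funext (prod_comp_eq_prod_pow_card f)
  rw [h1]
  refine Integrable.fintype_prod (f := fun k (x : ℝ) => x ^ Fintype.card {x // f x = k}) fun k => ?_
  have h2 := (memLp_id_gaussianReal (μ := 0) (v := 1)
    (Fintype.card {x // f x = k})).integrable_norm_pow'
  refine h2.mono' (by fun_prop) (Filter.Eventually.of_forall fun x => ?_)
  simp

open scoped Classical in
/-- The indicator function of the `a` that are constant on the orbits of `σ`. -/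
noncomputable def invariantIndicator {ι P : Type*} (σ : Equiv.Perm ι) (a : ι → P) : ℝ :=
  if a ∘ σ = a then 1 else 0

open scoped Classical in
open MeasureTheory ProbabilityTheory in
theorem integral_prod_entries_gaussian {ι P : Type*} [Fintype ι] [Fintype P] (a a' : ι → P) :
    ∫ g : P × P → ℝ, ∏ t, g (a t, a' t) ∂(Measure.pi fun _ => gaussianReal 0 1) =
      ∑ σ : {σ : Equiv.Perm ι // IsPerfectMatching σ},
        invariantIndicator σ.1 a * invariantIndicator σ.1 a' := by
  rw [integral_prod_comp_gaussian fun t => (a t, a' t)]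
  refine Finset.sum_congr rfl fun σ _ => ?_
  have : (fun t => (a t, a' t)) ∘ σ.1 = (fun t => (a t, a' t)) ↔ a ∘ σ.1 = a ∧ a' ∘ σ.1 = a' := by
    simp [funext_iff, forall_and]
  simp only [invariantIndicator, this]
  split_ifs <;> simp_all

/-- The matrix of the `ι`-th tensor power of the linear map with matrix `A`. -/
def tensorPowMatrix (ι : Type*) [Fintype ι] {K : Type*} (A : Matrix K K ℝ) :
    Matrix (ι → K) (ι → K) ℝ :=
  Matrix.of fun i j => ∏ t, A (i t) (j t)

section TensorPow

variable {ι K : Type*} [Fintype ι]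

theorem tensorPowMatrix_apply (A : Matrix K K ℝ) (i j : ι → K) :
    tensorPowMatrix ι A i j = ∏ t, A (i t) (j t) := rfl

theorem tensorPowMatrix_mul [Fintype K] [DecidableEq ι] (A B : Matrix K K ℝ) :
    tensorPowMatrix ι (A * B) = tensorPowMatrix ι A * tensorPowMatrix ι B := by
  ext i j
  simp only [Matrix.mul_apply, tensorPowMatrix_apply, Finset.prod_univ_sum,
    Finset.prod_mul_distrib, Fintype.piFinset_univ]

theorem tensorPowMatrix_transpose (A : Matrix K K ℝ) :
    tensorPowMatrix ι A.transpose = (tensorPowMatrix ι A).transpose := rfl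

theorem tensorPowMatrix_one [DecidableEq K] [DecidableEq ι] :
    tensorPowMatrix ι (1 : Matrix K K ℝ) = 1 := by
  ext i j
  simp [tensorPowMatrix_apply, Matrix.one_apply, Fintype.prod_ite_zero, funext_iff]

end TensorPow

open scoped Kronecker

/-- The matrix of the action of `(B, C, D)` on the `ι`-th tensor power of a triple tensor product. -/
def tripleActionMatrix (ι : Type*) [Fintype ι] {P Q R : Type*} (B : Matrix P P ℝ)
    (C : Matrix Q Q ℝ) (D : Matrix R R ℝ) : Matrix (ι → P × Q × R) (ι → P × Q × R) ℝ :=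
  tensorPowMatrix ι (B ⊗ₖ (C ⊗ₖ D))

/-- The coordinates of the tensor attached to a triple of perfect matchings. -/
noncomputable def brauerVector {ι : Type*} (P Q R : Type*) (σ τ ρ : Equiv.Perm ι)
    (i : ι → P × Q × R) : ℝ :=
  invariantIndicator σ (fun t => (i t).1) *
    (invariantIndicator τ (fun t => (i t).2.1) * invariantIndicator ρ (fun t => (i t).2.2))

theorem Matrix.PosSemidef.exists_posSemidef_mul_self {n : Type*} [Fintype n] [DecidableEq n]
    {M : Matrix n n ℝ} (hM : M.PosSemidef) : ∃ S : Matrix n n ℝ, S.PosSemidef ∧ S * S = M := by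
  open scoped MatrixOrder in
  exact ⟨CFC.sqrt M, Matrix.nonneg_iff_posSemidef.1 (CFC.sqrt_nonneg M),
    CFC.sqrt_mul_sqrt_self M hM.nonneg⟩

theorem Matrix.exists_polar_decomposition {n : Type*} [Fintype n] [DecidableEq n]
    {A : Matrix n n ℝ} (hA : A.det ≠ 0) :
    ∃ U ∈ Matrix.orthogonalGroup n ℝ, ∃ S : Matrix n n ℝ, A = U * (S.transpose * S) := by
  have hpos : (A.transpose * A).PosSemidef := Matrix.posSemidef_conjTranspose_mul_self A
  obtain ⟨T, hT, hsq⟩ := hpos.exists_posSemidef_mul_self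
  obtain ⟨S, hS, hST⟩ := hT.exists_posSemidef_mul_self
  have hSsymm : S.transpose = S := hS.isHermitian
  have hsymm : T.transpose = T := hT.isHermitian
  have hdet : IsUnit T.det := by
    rw [isUnit_iff_ne_zero]
    intro h
    have := congrArg Matrix.det hsq
    rw [Matrix.det_mul, Matrix.det_mul, Matrix.det_transpose, h] at this
    simp [hA] at this
  refine ⟨A * T⁻¹, ?_, S, ?_⟩
  · rw [Matrix.mem_orthogonalGroup_iff', Matrix.transpose_mul,
      Matrix.transpose_nonsing_inv, hsymm]
    calc T⁻¹ * A.transpose * (A * T⁻¹) = T⁻¹ * (A.transpose * A) * T⁻¹ := by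
          simp only [Matrix.mul_assoc]
      _ = (T⁻¹ * T) * (T * T⁻¹) := by rw [← hsq]; simp only [Matrix.mul_assoc]
      _ = 1 := by rw [Matrix.nonsing_inv_mul _ hdet, Matrix.mul_nonsing_inv _ hdet, one_mul]
  · rw [hSsymm, hST, Matrix.mul_assoc,
      Matrix.nonsing_inv_mul _ hdet, Matrix.mul_one]

theorem sum_mul_sum_triple_eq_sum_sq {I M : Type*} (s : Finset I) (m : Finset M) (x : I → ℝ)
    (u v w : M → I → ℝ) :
    ∑ i ∈ s, ∑ j ∈ s, x i * x j * ((∑ σ ∈ m, u σ i * u σ j) *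
        ((∑ τ ∈ m, v τ i * v τ j) * ∑ ρ ∈ m, w ρ i * w ρ j)) =
      ∑ σ ∈ m, ∑ τ ∈ m, ∑ ρ ∈ m, (∑ i ∈ s, x i * (u σ i * (v τ i * w ρ i))) ^ 2 := by
  have h (i j : I) : x i * x j * ((∑ σ ∈ m, u σ i * u σ j) *
      ((∑ τ ∈ m, v τ i * v τ j) * ∑ ρ ∈ m, w ρ i * w ρ j)) =
      ∑ σ ∈ m, ∑ τ ∈ m, ∑ ρ ∈ m,
        x i * (u σ i * (v τ i * w ρ i)) * (x j * (u σ j * (v τ j * w ρ j))) := by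
    simp_rw [Finset.sum_mul_sum, Finset.mul_sum]
    exact Finset.sum_congr rfl fun σ _ => Finset.sum_congr rfl fun τ _ =>
      Finset.sum_congr rfl fun ρ _ => by ring
  simp_rw [h, sq, Finset.sum_mul_sum]
  rw [Finset.sum_congr rfl fun i _ => Finset.sum_comm, Finset.sum_comm]
  refine Finset.sum_congr rfl fun σ _ => ?_
  rw [Finset.sum_congr rfl fun i _ => Finset.sum_comm, Finset.sum_comm]
  refine Finset.sum_congr rfl fun τ _ => ?_
  rw [Finset.sum_congr rfl fun i _ => Finset.sum_comm, Finset.sum_comm]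

section Invariants

variable {ι P Q R : Type*} [Fintype ι] [DecidableEq ι] [Fintype P] [Fintype Q] [Fintype R]

theorem tripleActionMatrix_mul (B B' : Matrix P P ℝ) (C C' : Matrix Q Q ℝ) (D D' : Matrix R R ℝ) :
    tripleActionMatrix ι (B * B') (C * C') (D * D') =
      tripleActionMatrix ι B C D * tripleActionMatrix ι B' C' D' := by
  simp only [tripleActionMatrix, Matrix.mul_kronecker_mul, tensorPowMatrix_mul]

omit [DecidableEq ι] [Fintype P] [Fintype Q] [Fintype R] in
theorem tripleActionMatrix_transpose (B : Matrix P P ℝ) (C : Matrix Q Q ℝ) (D : Matrix R R ℝ) :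
    tripleActionMatrix ι B.transpose C.transpose D.transpose =
      (tripleActionMatrix ι B C D).transpose := by
  simp only [tripleActionMatrix, ← tensorPowMatrix_transpose, Matrix.kroneckerMap_transpose]

omit [DecidableEq ι] [Fintype P] [Fintype Q] [Fintype R] in
theorem tripleActionMatrix_apply (B : Matrix P P ℝ) (C : Matrix Q Q ℝ) (D : Matrix R R ℝ)
    (i j : ι → P × Q × R) :
    tripleActionMatrix ι B C D i j = (∏ t, B (i t).1 (j t).1) *
      ((∏ t, C (i t).2.1 (j t).2.1) * ∏ t, D (i t).2.2 (j t).2.2) := by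
  simp [tripleActionMatrix, tensorPowMatrix_apply, Matrix.kroneckerMap_apply,
    Finset.prod_mul_distrib]

variable [DecidableEq P] [DecidableEq Q] [DecidableEq R]

/-- Invariance of a coordinate vector under the product of the three orthogonal groups. -/
def IsOrthogonalInvariant (x : (ι → P × Q × R) → ℝ) : Prop :=
  ∀ B ∈ Matrix.orthogonalGroup P ℝ, ∀ C ∈ Matrix.orthogonalGroup Q ℝ,
    ∀ D ∈ Matrix.orthogonalGroup R ℝ, (tripleActionMatrix ι B C D).mulVec x = x

theorem Matrix.transpose_mem_orthogonalGroup {n : Type*} [Fintype n] [DecidableEq n]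
    {U : Matrix n n ℝ} (hU : U ∈ Matrix.orthogonalGroup n ℝ) :
    U.transpose ∈ Matrix.orthogonalGroup n ℝ :=
  Unitary.star_mem hU

theorem IsOrthogonalInvariant.dotProduct_mulVec_nonneg_of_det_ne_zero
    {x : (ι → P × Q × R) → ℝ} (hx : IsOrthogonalInvariant x) {B : Matrix P P ℝ}
    {C : Matrix Q Q ℝ} {D : Matrix R R ℝ} (hB : B.det ≠ 0) (hC : C.det ≠ 0) (hD : D.det ≠ 0) :
    0 ≤ x ⬝ᵥ (tripleActionMatrix ι B C D).mulVec x := by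
  obtain ⟨U, hU, S, rfl⟩ := Matrix.exists_polar_decomposition hB
  obtain ⟨V, hV, T, rfl⟩ := Matrix.exists_polar_decomposition hC
  obtain ⟨W, hW, Z, rfl⟩ := Matrix.exists_polar_decomposition hD
  rw [tripleActionMatrix_mul, ← Matrix.mulVec_mulVec, Matrix.dotProduct_mulVec,
    ← Matrix.mulVec_transpose, ← tripleActionMatrix_transpose,
    hx _ (Matrix.transpose_mem_orthogonalGroup hU) _ (Matrix.transpose_mem_orthogonalGroup hV) _
      (Matrix.transpose_mem_orthogonalGroup hW),
    tripleActionMatrix_mul, ← Matrix.mulVec_mulVec, Matrix.dotProduct_mulVec,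
    ← Matrix.mulVec_transpose, ← tripleActionMatrix_transpose]
  simp only [Matrix.transpose_transpose]
  exact Finset.sum_nonneg fun i _ => mul_self_nonneg _

theorem Matrix.eventually_det_add_smul_one_ne_zero {n : Type*} [Fintype n] [DecidableEq n]
    (A : Matrix n n ℝ) :
    ∀ᶠ ε : ℝ in nhdsWithin 0 {0}ᶜ, (A + ε • (1 : Matrix n n ℝ)).det ≠ 0 := by
  have hfin : {ε : ℝ | (-A).charpoly.IsRoot ε}.Finite :=
    Polynomial.finite_setOfPred_isRoot (Matrix.charpoly_monic _).ne_zero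
  have h := nhdsNE_le_cofinite (0 : ℝ) hfin.compl_mem_cofinite
  filter_upwards [h] with ε hε hdet
  apply hε
  rw [Set.mem_ofPred_eq, Polynomial.IsRoot, Matrix.eval_charpoly, ← hdet]
  congr 1
  rw [Matrix.smul_one_eq_diagonal, Matrix.scalar_apply, sub_neg_eq_add, add_comm]

omit [DecidableEq ι] [Fintype P] [Fintype Q] [Fintype R] [DecidableEq P] [DecidableEq Q]
  [DecidableEq R] in
theorem Continuous.tripleActionMatrix {X : Type*} [TopologicalSpace X] {B : X → Matrix P P ℝ}
    {C : X → Matrix Q Q ℝ} {D : X → Matrix R R ℝ} (hB : Continuous B) (hC : Continuous C)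
    (hD : Continuous D) : Continuous fun y => tripleActionMatrix ι (B y) (C y) (D y) := by
  refine continuous_matrix fun i j => ?_
  simp only [tripleActionMatrix_apply]
  have h1 (a b) : Continuous fun y => B y a b := hB.matrix_elem a b
  have h2 (a b) : Continuous fun y => C y a b := hC.matrix_elem a b
  have h3 (a b) : Continuous fun y => D y a b := hD.matrix_elem a b
  fun_prop

theorem IsOrthogonalInvariant.dotProduct_mulVec_nonneg
    {x : (ι → P × Q × R) → ℝ} (hx : IsOrthogonalInvariant x) (B : Matrix P P ℝ)
    (C : Matrix Q Q ℝ) (D : Matrix R R ℝ) :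
    0 ≤ x ⬝ᵥ (tripleActionMatrix ι B C D).mulVec x := by
  have hcont : Continuous fun ε : ℝ => x ⬝ᵥ (_root_.tripleActionMatrix ι
      (B + ε • (1 : Matrix P P ℝ)) (C + ε • (1 : Matrix Q Q ℝ))
      (D + ε • (1 : Matrix R R ℝ))).mulVec x :=
    continuous_const.dotProduct
      ((Continuous.tripleActionMatrix (by fun_prop) (by fun_prop) (by fun_prop)).matrix_mulVec
        continuous_const)
  have htend := (hcont.tendsto 0).mono_left (nhdsWithin_le_nhds (s := {0}ᶜ))
  simp only [zero_smul, add_zero] at htend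
  refine ge_of_tendsto htend ?_
  filter_upwards [B.eventually_det_add_smul_one_ne_zero, C.eventually_det_add_smul_one_ne_zero,
    D.eventually_det_add_smul_one_ne_zero] with ε h1 h2 h3
  exact hx.dotProduct_mulVec_nonneg_of_det_ne_zero h1 h2 h3

omit [DecidableEq P] [DecidableEq Q] [DecidableEq R] in
theorem dotProduct_tripleActionMatrix_mulVec (x : (ι → P × Q × R) → ℝ) (B : Matrix P P ℝ)
    (C : Matrix Q Q ℝ) (D : Matrix R R ℝ) :
    x ⬝ᵥ (tripleActionMatrix ι B C D).mulVec x =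
      ∑ i, ∑ j, x i * x j * ((∏ t, B (i t).1 (j t).1) *
        ((∏ t, C (i t).2.1 (j t).2.1) * ∏ t, D (i t).2.2 (j t).2.2)) := by
  simp only [dotProduct, Matrix.mulVec, tripleActionMatrix_apply, Finset.mul_sum]
  exact Finset.sum_congr rfl fun i _ => Finset.sum_congr rfl fun j _ => by ring

open MeasureTheory ProbabilityTheory in
theorem IsOrthogonalInvariant.eq_zero_of_dotProduct_brauerVector_eq_zero
    {x : (ι → P × Q × R) → ℝ} (hx : IsOrthogonalInvariant x)
    (horth : ∀ σ τ ρ : Equiv.Perm ι, IsPerfectMatching σ → IsPerfectMatching τ →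
      IsPerfectMatching ρ → x ⬝ᵥ brauerVector P Q R σ τ ρ = 0) : x = 0 := by
  classical
  let F : (P × P → ℝ) × (Q × Q → ℝ) × (R × R → ℝ) → ℝ := fun g =>
    x ⬝ᵥ (tripleActionMatrix ι (Matrix.of fun a b => g.1 (a, b)) (Matrix.of fun a b => g.2.1 (a, b))
      (Matrix.of fun a b => g.2.2 (a, b))).mulVec x
  let μ : Measure ((P × P → ℝ) × (Q × Q → ℝ) × (R × R → ℝ)) :=
    (Measure.pi fun _ => gaussianReal 0 1).prod
      ((Measure.pi fun _ => gaussianReal 0 1).prod (Measure.pi fun _ => gaussianReal 0 1))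
  have hopen : (gaussianReal 0 1).IsOpenPosMeasure :=
    (gaussianReal_absolutelyContinuous' 0 one_ne_zero).isOpenPosMeasure
  have hF : F = fun g => ∑ i, ∑ j, x i * x j * ((∏ t, g.1 ((i t).1, (j t).1)) *
        ((∏ t, g.2.1 ((i t).2.1, (j t).2.1)) * ∏ t, g.2.2 ((i t).2.2, (j t).2.2))) :=
    funext fun g => dotProduct_tripleActionMatrix_mulVec x _ _ _
  have hcont : Continuous F := by rw [hF]; fun_prop
  have hnonneg : 0 ≤ F := fun g => hx.dotProduct_mulVec_nonneg _ _ _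
  have hsummand (i j : ι → P × Q × R) : Integrable (fun g : (P × P → ℝ) × (Q × Q → ℝ) × (R × R → ℝ) =>
      x i * x j * ((∏ t, g.1 ((i t).1, (j t).1)) *
        ((∏ t, g.2.1 ((i t).2.1, (j t).2.1)) * ∏ t, g.2.2 ((i t).2.2, (j t).2.2)))) μ :=
    ((integrable_prod_comp_gaussian fun t => ((i t).1, (j t).1)).mul_prod
      ((integrable_prod_comp_gaussian fun t => ((i t).2.1, (j t).2.1)).mul_prod
        (integrable_prod_comp_gaussian fun t => ((i t).2.2, (j t).2.2)))).const_mul _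
  have hzero : ∫ g, F g ∂μ = 0 := by
    rw [hF, integral_finsetSum _ fun i _ => integrable_finsetSum _ fun j _ => hsummand i j]
    rw [Finset.sum_congr rfl fun i _ => integral_finsetSum _ fun j _ => hsummand i j]
    simp only [integral_const_mul, μ]
    have h1 (i j : ι → P × Q × R) := integral_prod_mul
      (μ := Measure.pi fun _ : P × P => gaussianReal 0 1)
      (ν := (Measure.pi fun _ : Q × Q => gaussianReal 0 1).prod
        (Measure.pi fun _ : R × R => gaussianReal 0 1))
      (fun g => ∏ t, g ((i t).1, (j t).1))
      (fun g => (∏ t, g.1 ((i t).2.1, (j t).2.1)) * ∏ t, g.2 ((i t).2.2, (j t).2.2))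
    have h2 (i j : ι → P × Q × R) := integral_prod_mul
      (μ := Measure.pi fun _ : Q × Q => gaussianReal 0 1)
      (ν := Measure.pi fun _ : R × R => gaussianReal 0 1)
      (fun g => ∏ t, g ((i t).2.1, (j t).2.1)) (fun g => ∏ t, g ((i t).2.2, (j t).2.2))
    simp only [h1, h2, integral_prod_entries_gaussian]
    rw [sum_mul_sum_triple_eq_sum_sq _ _ x
      (fun (σ : {σ : Equiv.Perm ι // IsPerfectMatching σ}) i => invariantIndicator σ.1 fun t => (i t).1)
      (fun (σ : {σ : Equiv.Perm ι // IsPerfectMatching σ}) i => invariantIndicator σ.1 fun t => (i t).2.1)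
      (fun (σ : {σ : Equiv.Perm ι // IsPerfectMatching σ}) i => invariantIndicator σ.1 fun t => (i t).2.2)]
    exact Finset.sum_eq_zero fun σ _ => Finset.sum_eq_zero fun τ _ => Finset.sum_eq_zero fun ρ _ =>
      pow_eq_zero_iff two_ne_zero |>.2 (horth _ _ _ σ.2 τ.2 ρ.2)
  have hFint : Integrable F μ := by
    rw [hF]
    exact integrable_finsetSum _ fun i _ => integrable_finsetSum _ fun j _ => hsummand i j
  have hμ : μ.IsOpenPosMeasure := by
    have hP : (Measure.pi fun _ : P × P => gaussianReal 0 1).IsOpenPosMeasure :=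
      Measure.pi.isOpenPosMeasure _
    have hQ : (Measure.pi fun _ : Q × Q => gaussianReal 0 1).IsOpenPosMeasure :=
      Measure.pi.isOpenPosMeasure _
    have hR : (Measure.pi fun _ : R × R => gaussianReal 0 1).IsOpenPosMeasure :=
      Measure.pi.isOpenPosMeasure _
    have hQR := @Measure.prod.instIsOpenPosMeasure _ _ _ _ _ _ hQ _ _ hR _
    exact @Measure.prod.instIsOpenPosMeasure _ _ _ _ _ _ hP _ _ hQR _
  have hF0 : F = 0 := hcont.ae_eq_iff_eq μ continuous_zero |>.1
    ((integral_eq_zero_iff_of_nonneg hnonneg hFint).1 hzero)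
  have hone := congrFun hF0 (fun e => (1 : Matrix P P ℝ) e.1 e.2,
    fun e => (1 : Matrix Q Q ℝ) e.1 e.2, fun e => (1 : Matrix R R ℝ) e.1 e.2)
  change x ⬝ᵥ (tripleActionMatrix ι 1 1 1).mulVec x = 0 at hone
  rw [tripleActionMatrix, Matrix.one_kronecker_one, Matrix.one_kronecker_one, tensorPowMatrix_one,
    Matrix.one_mulVec] at hone
  exact dotProduct_self_eq_zero.1 hone

end Invariants

theorem IsPerfectMatching.prod_eq_prod_lt {ι M : Type*} [Fintype ι] [LinearOrder ι] [CommMonoid M]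
    {σ : Equiv.Perm ι} (hσ : IsPerfectMatching σ) (F : ι → M) :
    ∏ t, F t = ∏ t : {t // t < σ t}, F t * F (σ t) := by
  rw [← Finset.prod_filter_mul_prod_filter_not Finset.univ (fun t => t < σ t), Finset.prod_mul_distrib]
  rw [← Finset.prod_subtype_eq_prod_filter, ← Finset.prod_subtype_eq_prod_filter]
  simp only [Finset.subtype_univ]
  congr 1
  refine Fintype.prod_equiv (σ.subtypeEquiv fun t => ?_) _ _ fun t => by simp [hσ.1]
  rw [hσ.1, not_lt, le_iff_lt_or_eq, or_iff_left (hσ.2 t)]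

theorem IsPerfectMatching.sum_prod_eq {ι P S : Type*} [Fintype ι] [LinearOrder ι] [Fintype P]
    [CommSemiring S] {σ : Equiv.Perm ι} {_ : DecidablePred fun a : ι → P => a ∘ σ = a}
    (hσ : IsPerfectMatching σ) (F : ι → P → S) :
    ∑ a : ι → P with a ∘ σ = a, ∏ t, F t (a t) = ∏ t : {t // t < σ t}, ∑ k, F t k * F (σ t) k := by
  have hflip {t : ι} (ht : ¬ t < σ t) : σ t < σ (σ t) := by
    rw [hσ.1]; exact lt_of_le_of_ne (not_lt.1 ht) (hσ.2 t)
  rw [Finset.prod_univ_sum, Fintype.piFinset_univ]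
  refine Finset.sum_bij' (fun a _ t => a t)
    (fun c _ t => if h : t < σ t then c ⟨t, h⟩ else c ⟨σ t, hflip h⟩) (by simp) ?_ ?_ ?_ ?_
  · intro c _
    rw [Finset.mem_filter]
    refine ⟨Finset.mem_univ _, funext fun t => ?_⟩
    rcases lt_or_gt_of_ne (hσ.2 t) with h | h
    · simp [hσ.1, h, h.not_gt]
    · simp [hσ.1, h, h.not_gt]
  · intro a ha
    have ha' := (Finset.mem_filter.1 ha).2
    ext t
    dsimp only
    split_ifs
    · rfl
    · exact congrFun ha' t
  · intro c _
    ext t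
    simp [t.2]
  · intro a ha
    have ha' := (Finset.mem_filter.1 ha).2
    rw [hσ.prod_eq_prod_lt]
    refine Finset.prod_congr rfl fun t _ => ?_
    rw [show a (σ t) = a t from congrFun ha' t]

theorem IsPerfectMatching.sum_prod_mul_invariantIndicator {ι P : Type*} [Fintype ι]
    [LinearOrder ι] [Fintype P] [DecidableEq P] {σ : Equiv.Perm ι} (hσ : IsPerfectMatching σ)
    {B : Matrix P P ℝ} (hB : B ∈ Matrix.orthogonalGroup P ℝ) (a : ι → P) :
    ∑ b : ι → P, (∏ t, B (a t) (b t)) * invariantIndicator σ b = invariantIndicator σ a := by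
  classical
  have hBB (k l : P) : ∑ m, B k m * B l m = (1 : Matrix P P ℝ) k l := by
    rw [← (Matrix.mem_orthogonalGroup_iff P ℝ).1 hB]
    rfl
  simp only [invariantIndicator, mul_ite, mul_one, mul_zero]
  rw [← Finset.sum_filter, hσ.sum_prod_eq fun t k => B (a t) k]
  simp only [hBB, Matrix.one_apply]
  rw [Fintype.prod_ite_zero, Finset.prod_const_one]
  have key : (∀ t : {t // t < σ t}, a t = a (σ t)) ↔ a ∘ σ = a := by
    refine ⟨fun h => funext fun t => ?_, fun h t => (congrFun h t).symm⟩
    rcases lt_or_gt_of_ne (hσ.2 t) with ht | ht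
    · simpa [hσ.1] using h ⟨σ t, by rwa [hσ.1]⟩
    · exact (h ⟨t, ht⟩).symm
  simp only [key]
  congr

theorem isOrthogonalInvariant_brauerVector {ι P Q R : Type*} [Fintype ι] [LinearOrder ι]
    [Fintype P] [Fintype Q] [Fintype R] [DecidableEq P] [DecidableEq Q] [DecidableEq R]
    {σ τ ρ : Equiv.Perm ι} (hσ : IsPerfectMatching σ) (hτ : IsPerfectMatching τ)
    (hρ : IsPerfectMatching ρ) : IsOrthogonalInvariant (brauerVector P Q R σ τ ρ) := by
  intro B hB C hC D hD
  ext i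
  simp only [Matrix.mulVec, dotProduct, tripleActionMatrix_apply]
  rw [brauerVector, ← hσ.sum_prod_mul_invariantIndicator hB,
    ← hτ.sum_prod_mul_invariantIndicator hC, ← hρ.sum_prod_mul_invariantIndicator hD]
  simp only [Finset.sum_mul_sum]
  simp only [Finset.mul_sum, ← Fintype.sum_prod_type']
  refine Fintype.sum_equiv ((Equiv.arrowProdEquivProdArrow ι _ _).trans
    (Equiv.prodCongr (Equiv.refl _) (Equiv.arrowProdEquivProdArrow ι _ _))) _ _ fun j => ?_
  simp only [brauerVector, Equiv.trans_apply, Equiv.arrowProdEquivProdArrow, Equiv.prodCongr_apply,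
    Equiv.coe_fn_mk, Prod.map_apply, Equiv.refl_apply]
  ring

/-- The basis of the tensor power of a triple tensor product given by the standard bases. -/
noncomputable def tripleTensorBasis (ι P Q R : Type*) [Fintype ι] [Fintype P] [Fintype Q]
    [Fintype R] : Module.Basis (ι → P × Q × R) ℝ
      (⨂[ℝ] _ : ι, (EuclideanSpace ℝ P ⊗[ℝ] (EuclideanSpace ℝ Q ⊗[ℝ] EuclideanSpace ℝ R))) :=
  Basis.piTensorProduct fun _ => (EuclideanSpace.basisFun P ℝ).toBasis.tensorProduct
    ((EuclideanSpace.basisFun Q ℝ).toBasis.tensorProduct (EuclideanSpace.basisFun R ℝ).toBasis)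

section Coordinates

variable {ι P Q R : Type*} [Fintype ι] [Fintype P] [Fintype Q] [Fintype R]

theorem tripleTensorBasis_repr_tprod (u : ι → EuclideanSpace ℝ P) (v : ι → EuclideanSpace ℝ Q)
    (w : ι → EuclideanSpace ℝ R) (i : ι → P × Q × R) :
    (tripleTensorBasis ι P Q R).repr (PiTensorProduct.tprod ℝ fun t => u t ⊗ₜ[ℝ] (v t ⊗ₜ[ℝ] w t)) i =
      ∏ t, u t (i t).1 * (v t (i t).2.1 * w t (i t).2.2) := by
  rw [tripleTensorBasis, Basis.piTensorProduct_repr_tprod_apply]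
  refine Finset.prod_congr rfl fun t _ => ?_
  obtain ⟨a, b, c⟩ := i t
  simp [Module.Basis.tensorProduct_repr_tmul_apply]
  ring

variable [DecidableEq P] [DecidableEq Q] [DecidableEq R]

theorem tripleTensorBasis_apply (j : ι → P × Q × R) :
    tripleTensorBasis ι P Q R j = PiTensorProduct.tprod ℝ fun t =>
      EuclideanSpace.single (j t).1 (1 : ℝ) ⊗ₜ[ℝ] (EuclideanSpace.single (j t).2.1 (1 : ℝ) ⊗ₜ[ℝ]
        EuclideanSpace.single (j t).2.2 (1 : ℝ)) := by
  simp [tripleTensorBasis, Basis.piTensorProduct_apply, Module.Basis.tensorProduct_apply']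

variable [DecidableEq ι]

theorem tripleTensorBasis_equivFun_map (B : Matrix P P ℝ) (C : Matrix Q Q ℝ) (D : Matrix R R ℝ)
    (x : ⨂[ℝ] _ : ι, (EuclideanSpace ℝ P ⊗[ℝ] (EuclideanSpace ℝ Q ⊗[ℝ] EuclideanSpace ℝ R))) :
    (tripleTensorBasis ι P Q R).equivFun (PiTensorProduct.map (fun _ : ι =>
        TensorProduct.map (Matrix.toEuclideanLin B)
          (TensorProduct.map (Matrix.toEuclideanLin C) (Matrix.toEuclideanLin D))) x) =
      (tripleActionMatrix ι B C D).mulVec ((tripleTensorBasis ι P Q R).equivFun x) := by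
  have h : (tripleTensorBasis ι P Q R).equivFun.toLinearMap ∘ₗ PiTensorProduct.map (fun _ : ι =>
        TensorProduct.map (Matrix.toEuclideanLin B)
          (TensorProduct.map (Matrix.toEuclideanLin C) (Matrix.toEuclideanLin D))) =
      (tripleActionMatrix ι B C D).mulVecLin ∘ₗ (tripleTensorBasis ι P Q R).equivFun.toLinearMap := by
    refine (tripleTensorBasis ι P Q R).ext fun j => funext fun i => ?_
    have hj : (tripleTensorBasis ι P Q R).equivFun (tripleTensorBasis ι P Q R j) =
        Pi.single j 1 := by
      rw [Module.Basis.equivFun_apply, Module.Basis.repr_self, Finsupp.single_eq_pi_single]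
    simp only [LinearMap.comp_apply, LinearEquiv.coe_coe, hj, Matrix.mulVecLin_apply,
      Matrix.mulVec_single_one, Matrix.col_apply, tripleActionMatrix_apply]
    rw [tripleTensorBasis_apply, PiTensorProduct.map_tprod]
    simp only [TensorProduct.map_tmul, Module.Basis.equivFun_apply, tripleTensorBasis_repr_tprod,
      Finset.prod_mul_distrib]
    simp
  exact LinearMap.congr_fun h x

omit [DecidableEq P] [DecidableEq Q] [DecidableEq R] in
theorem exists_brauer_decomposition (x : (ι → P × Q × R) → ℝ) :
    ∃ s ∈ Submodule.span ℝ {v : (ι → P × Q × R) → ℝ | ∃ σ τ ρ : Equiv.Perm ι,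
        IsPerfectMatching σ ∧ IsPerfectMatching τ ∧ IsPerfectMatching ρ ∧
          v = brauerVector P Q R σ τ ρ},
      ∀ σ τ ρ : Equiv.Perm ι, IsPerfectMatching σ → IsPerfectMatching τ → IsPerfectMatching ρ →
        (x - s) ⬝ᵥ brauerVector P Q R σ τ ρ = 0 := by
  let e := WithLp.linearEquiv 2 ℝ ((ι → P × Q × R) → ℝ)
  set S := Submodule.span ℝ {v : (ι → P × Q × R) → ℝ | ∃ σ τ ρ : Equiv.Perm ι,
        IsPerfectMatching σ ∧ IsPerfectMatching τ ∧ IsPerfectMatching ρ ∧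
          v = brauerVector P Q R σ τ ρ}
  let K : Submodule ℝ (EuclideanSpace ℝ (ι → P × Q × R)) := S.comap e.toLinearMap
  obtain ⟨s, hs, y, hy, hxy⟩ := K.exists_add_mem_mem_orthogonal (WithLp.toLp 2 x)
  refine ⟨s.ofLp, hs, fun σ τ ρ hσ hτ hρ => ?_⟩
  have h1 : x - s.ofLp = y.ofLp := by
    rw [← WithLp.ofLp_toLp 2 x, hxy]
    simp
  have h2 := (Submodule.mem_orthogonal _ _).1 hy (WithLp.toLp 2 (brauerVector P Q R σ τ ρ))
    (Submodule.subset_span ⟨σ, τ, ρ, hσ, hτ, hρ, rfl⟩)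
  rw [h1]
  simpa [EuclideanSpace.inner_eq_star_dotProduct] using h2

theorem IsOrthogonalInvariant.add {x y : (ι → P × Q × R) → ℝ} (hx : IsOrthogonalInvariant x)
    (hy : IsOrthogonalInvariant y) : IsOrthogonalInvariant (x + y) := fun B hB C hC D hD => by
  rw [Matrix.mulVec_add, hx B hB C hC D hD, hy B hB C hC D hD]

theorem IsOrthogonalInvariant.smul (c : ℝ) {x : (ι → P × Q × R) → ℝ}
    (hx : IsOrthogonalInvariant x) : IsOrthogonalInvariant (c • x) := fun B hB C hC D hD => by
  rw [Matrix.mulVec_smul, hx B hB C hC D hD]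

end Coordinates

theorem isOrthogonalInvariant_iff_mem_span {ι P Q R : Type*} [Fintype ι] [LinearOrder ι]
    [Fintype P] [Fintype Q] [Fintype R] [DecidableEq P] [DecidableEq Q] [DecidableEq R]
    (x : (ι → P × Q × R) → ℝ) : IsOrthogonalInvariant x ↔
      x ∈ Submodule.span ℝ {v : (ι → P × Q × R) → ℝ | ∃ σ τ ρ : Equiv.Perm ι,
        IsPerfectMatching σ ∧ IsPerfectMatching τ ∧ IsPerfectMatching ρ ∧
          v = brauerVector P Q R σ τ ρ} := by
  have hspan {y : (ι → P × Q × R) → ℝ} (hy : y ∈ Submodule.span ℝ {v : (ι → P × Q × R) → ℝ |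
      ∃ σ τ ρ : Equiv.Perm ι, IsPerfectMatching σ ∧ IsPerfectMatching τ ∧ IsPerfectMatching ρ ∧
        v = brauerVector P Q R σ τ ρ}) : IsOrthogonalInvariant y := by
    induction hy using Submodule.span_induction with
    | mem y hy =>
      obtain ⟨σ, τ, ρ, hσ, hτ, hρ, rfl⟩ := hy
      exact isOrthogonalInvariant_brauerVector hσ hτ hρ
    | zero => exact fun B _ C _ D _ => Matrix.mulVec_zero _
    | add _ _ _ _ h1 h2 => exact h1.add h2
    | smul c _ _ h => exact h.smul c
  refine ⟨fun hx => ?_, hspan⟩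
  obtain ⟨s, hs, horth⟩ := exists_brauer_decomposition x
  have hinv : IsOrthogonalInvariant (x - s) := by
    rw [sub_eq_add_neg, ← neg_one_smul ℝ s]
    exact hx.add ((hspan hs).smul _)
  rw [sub_eq_zero.1 (hinv.eq_zero_of_dotProduct_brauerVector_eq_zero horth)]
  exact hs

theorem prod_ite_eq_zero_one {ι P : Type*} [Fintype ι] [DecidableEq P] (f g : ι → P) :
    ∏ t, (if g t = f t then (1 : ℝ) else 0) = if f = g then 1 else 0 := by
  rw [Fintype.prod_ite_zero, Finset.prod_const_one]
  exact if_congr (by rw [eq_comm, funext_iff]) rfl rfl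

theorem equivFun_coloredBrauerTensor (p q r d : ℕ) (σ τ ρ : Equiv.Perm (Fin d)) :
    (tripleTensorBasis (Fin d) (Fin p) (Fin q) (Fin r)).equivFun
      (coloredBrauerTensor p q r d σ τ ρ) = brauerVector (Fin p) (Fin q) (Fin r) σ τ ρ := by
  classical
  ext i
  simp only [coloredBrauerTensor, map_sum, Finset.sum_apply, Module.Basis.equivFun_apply,
    tripleTensorBasis_repr_tprod, Finset.prod_mul_distrib, PiLp.single_apply,
    prod_ite_eq_zero_one, ← Finset.mul_sum, ← Finset.sum_mul]
  simp only [Finset.sum_ite_eq', Finset.mem_filter, Finset.mem_univ, true_and]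
  simp only [brauerVector, invariantIndicator]
  congr

theorem stmt_6 (p q r : ℕ) (hp : 1 ≤ p) (hq : 1 ≤ q) (hr : 1 ≤ r) (d : ℕ) (hd : 0 < d) :
    {x : ⨂[ℝ] _ : Fin d,
        (EuclideanSpace ℝ (Fin p) ⊗[ℝ] (EuclideanSpace ℝ (Fin q) ⊗[ℝ] EuclideanSpace ℝ (Fin r))) |
        ∀ B ∈ Matrix.orthogonalGroup (Fin p) ℝ, ∀ C ∈ Matrix.orthogonalGroup (Fin q) ℝ,
          ∀ D ∈ Matrix.orthogonalGroup (Fin r) ℝ,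
            PiTensorProduct.map (fun _ : Fin d =>
              TensorProduct.map
                (Matrix.toEuclideanLin B : EuclideanSpace ℝ (Fin p) →ₗ[ℝ] EuclideanSpace ℝ (Fin p))
                (TensorProduct.map
                  (Matrix.toEuclideanLin C :
                    EuclideanSpace ℝ (Fin q) →ₗ[ℝ] EuclideanSpace ℝ (Fin q))
                  (Matrix.toEuclideanLin D :
                    EuclideanSpace ℝ (Fin r) →ₗ[ℝ] EuclideanSpace ℝ (Fin r)))) x = x} =
      ↑(Submodule.span ℝ
        {t : ⨂[ℝ] _ : Fin d,
            (EuclideanSpace ℝ (Fin p) ⊗[ℝ]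
              (EuclideanSpace ℝ (Fin q) ⊗[ℝ] EuclideanSpace ℝ (Fin r))) |
          ∃ σ τ ρ : Equiv.Perm (Fin d),
            IsBrauerDiagram σ ∧ IsBrauerDiagram τ ∧ IsBrauerDiagram ρ ∧
              t = coloredBrauerTensor p q r d σ τ ρ}) := by
  set E := (tripleTensorBasis (Fin d) (Fin p) (Fin q) (Fin r)).equivFun
  have hspan : (Submodule.span ℝ {t | ∃ σ τ ρ : Equiv.Perm (Fin d), IsBrauerDiagram σ ∧
        IsBrauerDiagram τ ∧ IsBrauerDiagram ρ ∧ t = coloredBrauerTensor p q r d σ τ ρ}).map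
        E.toLinearMap =
      Submodule.span ℝ {v | ∃ σ τ ρ : Equiv.Perm (Fin d), IsPerfectMatching σ ∧
        IsPerfectMatching τ ∧ IsPerfectMatching ρ ∧
          v = brauerVector (Fin p) (Fin q) (Fin r) σ τ ρ} := by
    rw [Submodule.map_span]
    congr 1
    ext v
    constructor
    · rintro ⟨_, ⟨σ, τ, ρ, hσ, hτ, hρ, rfl⟩, rfl⟩
      exact ⟨σ, τ, ρ, hσ, hτ, hρ, equivFun_coloredBrauerTensor p q r d σ τ ρ⟩
    · rintro ⟨σ, τ, ρ, hσ, hτ, hρ, rfl⟩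
      exact ⟨_, ⟨σ, τ, ρ, hσ, hτ, hρ, rfl⟩, equivFun_coloredBrauerTensor p q r d σ τ ρ⟩
  ext x
  refine Iff.trans ?_ (E.injective.mem_set_image (a := x))
  change _ ↔ E x ∈ Submodule.map E.toLinearMap _
  rw [hspan, ← isOrthogonalInvariant_iff_mem_span]
  refine forall₂_congr fun B hB => forall₂_congr fun C hC => forall₂_congr fun D hD => ?_
  rw [← E.injective.eq_iff, tripleTensorBasis_equivFun_map]
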